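/- Suppose the operator L satisfies the positive maximum principle on M₊(E). Then q₀(g,g) = 0 for every g ∈ C(E) with g ≥ 0, and consequently q₀ vanishes identically: q₀(g,h) = 0 for all g, h ∈ C(E) (using that every g ∈ C(E) decomposes as g = g⁺ − g⁻ with g⁺, g⁻ ≥ 0, so that g⊗g = 2g⁺⊗g⁺ + 2g⁻⊗g⁻ − (g⁺+g⁻)⊗(g⁺+g⁻)). -/

import Mathlib

open MeasureTheory Topology

/-- The topological support of a measure: points all of whose open neighborhoods
have positive measure. -/
def mSupport {E : Type*} [TopologicalSpace E] [MeasurableSpace E]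
    (ν : Measure E) : Set E :=
  {x : E | ∀ U : Set E, IsOpen U → x ∈ U → 0 < ν U}

/-- The action of the operator `L` (with parameters `b₀, b₁, q₀, q₁, q₂`) on the cylindrical
function `ν ↦ φ(⟨g₁,ν⟩, …, ⟨g_m,ν⟩)`, evaluated at `ν`. -/
noncomputable def Lapp {E : Type*} [MetricSpace E] [MeasurableSpace E]
    (b₀ : C(E, ℝ) →ₗ[ℝ] ℝ) (b₁ : C(E, ℝ) →ₗ[ℝ] C(E, ℝ))
    (q₀ : C(E, ℝ) →ₗ[ℝ] C(E, ℝ) →ₗ[ℝ] ℝ)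
    (q₁ : C(E, ℝ) →ₗ[ℝ] C(E, ℝ) →ₗ[ℝ] C(E, ℝ))
    (q₂ : C(E, ℝ) →ₗ[ℝ] C(E, ℝ) →ₗ[ℝ] C(E × E, ℝ))
    (m : ℕ) (φ : (Fin m → ℝ) → ℝ) (g : Fin m → C(E, ℝ)) (ν : FiniteMeasure E) : ℝ :=
  (∑ i, fderiv ℝ φ (fun k => ∫ x, g k x ∂(ν : Measure E)) (Pi.single i 1) *
      (b₀ (g i) + ∫ x, b₁ (g i) x ∂(ν : Measure E))) +
  (1 / 2) * ∑ i, ∑ j,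
    (fderiv ℝ (fun w => fderiv ℝ φ w (Pi.single i 1))
        (fun k => ∫ x, g k x ∂(ν : Measure E)) (Pi.single j 1)) *
      (q₀ (g i) (g j) + (∫ x, q₁ (g i) (g j) x ∂(ν : Measure E)) +
        ∫ p, q₂ (g i) (g j) p ∂((ν : Measure E).prod (ν : Measure E)))

/-- `φ : ℝ^m → ℝ` is a polynomial function. -/
def IsPolyFn {m : ℕ} (φ : (Fin m → ℝ) → ℝ) : Prop :=
  ∃ P : MvPolynomial (Fin m) ℝ, ∀ v, φ v = MvPolynomial.eval v P

/-- The operator `L` satisfies the positive maximum principle on `M₊(E)`: for every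
cylindrical function `f(ν) = φ(⟨g₁,ν⟩, …, ⟨g_m,ν⟩)` whose outer function `φ` is smooth and
either a polynomial or compactly supported, and every global maximizer `ν*` of `f` over
`M₊(E)` with `f(ν*) ≥ 0`, one has `Lf(ν*) ≤ 0`. -/
def SatisfiesPMP {E : Type*} [MetricSpace E] [MeasurableSpace E]
    (b₀ : C(E, ℝ) →ₗ[ℝ] ℝ) (b₁ : C(E, ℝ) →ₗ[ℝ] C(E, ℝ))
    (q₀ : C(E, ℝ) →ₗ[ℝ] C(E, ℝ) →ₗ[ℝ] ℝ)
    (q₁ : C(E, ℝ) →ₗ[ℝ] C(E, ℝ) →ₗ[ℝ] C(E, ℝ))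
    (q₂ : C(E, ℝ) →ₗ[ℝ] C(E, ℝ) →ₗ[ℝ] C(E × E, ℝ)) : Prop :=
  ∀ (m : ℕ) (φ : (Fin m → ℝ) → ℝ), ContDiff ℝ (⊤ : ℕ∞) φ →
    (IsPolyFn φ ∨ HasCompactSupport φ) →
    ∀ (g : Fin m → C(E, ℝ)) (νstar : FiniteMeasure E),
      (∀ ν : FiniteMeasure E,
        φ (fun i => ∫ x, g i x ∂(ν : Measure E)) ≤
          φ (fun i => ∫ x, g i x ∂(νstar : Measure E))) →
      0 ≤ φ (fun i => ∫ x, g i x ∂(νstar : Measure E)) →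
      Lapp b₀ b₁ q₀ q₁ q₂ m φ g νstar ≤ 0

/-- The derivative of a function of one coordinate along that coordinate. -/
theorem fderiv_comp_apply_single {m : ℕ} {p : ℝ → ℝ} {p' : ℝ} (i : Fin m) (w : Fin m → ℝ)
    (hp : HasDerivAt p p' (w i)) :
    fderiv ℝ (fun v : Fin m → ℝ => p (v i)) w (Pi.single i 1) = p' := by
  have h := hp.comp_hasFDerivAt w (ContinuousLinearMap.proj (R := ℝ) (φ := fun _ => ℝ) i).hasFDerivAt
  have h' : HasFDerivAt (fun v : Fin m → ℝ => p (v i)) _ w := h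
  simp [h'.fderiv]

/-- The action of `L` at the zero measure on a function of a single pairing. -/
theorem Lapp_one_zero {E : Type*} [MetricSpace E] [MeasurableSpace E]
    (b₀ : C(E, ℝ) →ₗ[ℝ] ℝ) (b₁ : C(E, ℝ) →ₗ[ℝ] C(E, ℝ))
    (q₀ : C(E, ℝ) →ₗ[ℝ] C(E, ℝ) →ₗ[ℝ] ℝ)
    (q₁ : C(E, ℝ) →ₗ[ℝ] C(E, ℝ) →ₗ[ℝ] C(E, ℝ))
    (q₂ : C(E, ℝ) →ₗ[ℝ] C(E, ℝ) →ₗ[ℝ] C(E × E, ℝ))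
    {p p' : ℝ → ℝ} {p'' : ℝ} (hp : ∀ x, HasDerivAt p (p' x) x) (hp' : HasDerivAt p' p'' 0)
    (g : C(E, ℝ)) :
    Lapp b₀ b₁ q₀ q₁ q₂ 1 (fun v => p (v 0)) (fun _ => g) 0 =
      p' 0 * b₀ g + 1 / 2 * (p'' * q₀ g g) := by
  have h1 : ∀ w : Fin 1 → ℝ,
      fderiv ℝ (fun v : Fin 1 → ℝ => p (v 0)) w (Pi.single 0 1) = p' (w 0) :=
    fun w => fderiv_comp_apply_single 0 w (hp _)
  have h2 : fderiv ℝ (fun v : Fin 1 → ℝ => p' (v 0)) (fun _ => 0) (Pi.single 0 1) = p'' :=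
    fderiv_comp_apply_single 0 _ hp'
  simp only [Lapp, Fin.sum_univ_one, FiniteMeasure.toMeasure_zero, integral_zero_measure,
    Measure.zero_prod, h1, h2, add_zero]

/-- Under the positive maximum principle, `q₀` vanishes on the diagonal at nonnegative
functions: test with `-x (1 - c x)²`, which is maximal over `[0, ∞)` at `0`. -/
theorem SatisfiesPMP.q₀_self_eq_zero {E : Type*} [MetricSpace E] [MeasurableSpace E]
    {b₀ : C(E, ℝ) →ₗ[ℝ] ℝ} {b₁ : C(E, ℝ) →ₗ[ℝ] C(E, ℝ)}
    {q₀ : C(E, ℝ) →ₗ[ℝ] C(E, ℝ) →ₗ[ℝ] ℝ}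
    {q₁ : C(E, ℝ) →ₗ[ℝ] C(E, ℝ) →ₗ[ℝ] C(E, ℝ)}
    {q₂ : C(E, ℝ) →ₗ[ℝ] C(E, ℝ) →ₗ[ℝ] C(E × E, ℝ)}
    (hPMP : SatisfiesPMP b₀ b₁ q₀ q₁ q₂) {g : C(E, ℝ)} (hg : ∀ x, 0 ≤ g x) :
    q₀ g g = 0 := by
  have key : ∀ c : ℝ, -b₀ g + 2 * c * q₀ g g ≤ 0 := by
    intro c
    have hp : ∀ x : ℝ, HasDerivAt (fun x : ℝ => -x + 2 * c * x ^ 2 - c ^ 2 * x ^ 3)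
        (-1 + 4 * c * x - 3 * c ^ 2 * x ^ 2) x := fun x => by
      refine HasDerivAt.congr_deriv (((hasDerivAt_id' x).fun_neg.fun_add
        ((hasDerivAt_pow 2 x).const_mul (2 * c))).fun_sub
        ((hasDerivAt_pow 3 x).const_mul (c ^ 2))) ?_
      push_cast
      ring
    have hp' : HasDerivAt (fun x : ℝ => -1 + 4 * c * x - 3 * c ^ 2 * x ^ 2) (4 * c) 0 := by
      refine HasDerivAt.congr_deriv ((((hasDerivAt_id' (0 : ℝ)).const_mul (4 * c)).const_add
        (-1)).fun_sub ((hasDerivAt_pow 2 (0 : ℝ)).const_mul (3 * c ^ 2))) ?_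
      simp
    have h := hPMP 1 (fun v => -v 0 + 2 * c * v 0 ^ 2 - c ^ 2 * v 0 ^ 3) (by fun_prop)
      (Or.inl ⟨-.X 0 + .C (2 * c) * .X 0 ^ 2 - .C (c ^ 2) * .X 0 ^ 3, fun v => by simp⟩)
      (fun _ => g) 0 (fun ν => ?_) (by simp)
    · rw [Lapp_one_zero b₀ b₁ q₀ q₁ q₂ hp hp' g] at h
      linarith
    · have hx : 0 ≤ ∫ x, g x ∂(ν : Measure E) := integral_nonneg hg
      have := mul_nonneg hx (sq_nonneg (1 - c * ∫ x, g x ∂(ν : Measure E)))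
      simp only [FiniteMeasure.toMeasure_zero, integral_zero_measure]
      linarith
  by_contra hne
  have h := key ((b₀ g + 1) / (2 * q₀ g g))
  field_simp at h
  linarith

/-- If `L` satisfies the positive maximum principle on `M₊(E)`, then `q₀(g,g) = 0` for all
`g ≥ 0`, and consequently `q₀` vanishes identically. -/
theorem stmt_10 {E : Type*} [MetricSpace E] [CompactSpace E] [MeasurableSpace E] [BorelSpace E]
    (b₀ : C(E, ℝ) →ₗ[ℝ] ℝ) (b₁ : C(E, ℝ) →ₗ[ℝ] C(E, ℝ))
    (q₀ : C(E, ℝ) →ₗ[ℝ] C(E, ℝ) →ₗ[ℝ] ℝ)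
    (q₁ : C(E, ℝ) →ₗ[ℝ] C(E, ℝ) →ₗ[ℝ] C(E, ℝ))
    (q₂ : C(E, ℝ) →ₗ[ℝ] C(E, ℝ) →ₗ[ℝ] C(E × E, ℝ))
    (hq₀ : ∀ g h : C(E, ℝ), q₀ g h = q₀ h g)
    (hq₁ : ∀ g h : C(E, ℝ), q₁ g h = q₁ h g)
    (hq₂ : ∀ g h : C(E, ℝ), q₂ g h = q₂ h g)
    (hq₂val : ∀ (g h : C(E, ℝ)) (x y : E), q₂ g h (x, y) = q₂ g h (y, x))
    (hPMP : SatisfiesPMP b₀ b₁ q₀ q₁ q₂) :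
    (∀ g : C(E, ℝ), (∀ x, 0 ≤ g x) → q₀ g g = 0) ∧
    (∀ g h : C(E, ℝ), q₀ g h = 0) := by
  have hdiag : ∀ g : C(E, ℝ), (∀ x, 0 ≤ g x) → q₀ g g = 0 := fun g hg =>
    hPMP.q₀_self_eq_zero hg
  refine ⟨hdiag, fun g h => ?_⟩
  have hpos : ∀ g h : C(E, ℝ), 0 ≤ g → 0 ≤ h → q₀ g h = 0 := fun g h hg hh => by
    have hsum := hdiag (g + h) fun x => add_nonneg (hg x) (hh x)
    simp only [map_add, LinearMap.add_apply, hdiag g hg, hdiag h hh, hq₀ h g] at hsum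
    linarith
  rw [← posPart_sub_negPart g, ← posPart_sub_negPart h]
  simp only [map_sub, LinearMap.sub_apply, hpos _ _ (posPart_nonneg _) (posPart_nonneg _),
    hpos _ _ (posPart_nonneg _) (negPart_nonneg _), hpos _ _ (negPart_nonneg _) (posPart_nonneg _),
    hpos _ _ (negPart_nonneg _) (negPart_nonneg _), sub_zero]
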